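/- arXiv:math/0005150 — 2 statements merged into one kernel-verified Lean document; each statement's English description precedes it below -/
import Mathlib

section
/- (Commutative case of Lemma 3.1.) Let (Ω, μ) be an atomless probability space, 1 ≤ p < 2, and let (f_n) be a bounded unconditional sequence in L^p(μ) such that the family (|f_n|^p)_{n∈ℕ} is uniformly integrable. Then lim_{n→∞} n^{-1/p} ‖f_1 + ⋯ + f_n‖_{L^p(μ)} = 0. -/
open MeasureTheory Filter
open scoped ENNReal NNReal BigOperators

noncomputable section

variable {E : Type*} [NormedAddCommGroup E] [NormedSpace ℝ E]

/-- `x` is `K`-equivalent to the usual `ℓ^q` basis. -/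
def IsLqBasisEquiv (q K : ℝ) (x : ℕ → E) : Prop :=
  ∀ (s : Finset ℕ) (a : ℕ → ℝ),
    (1 / K) * (∑ k ∈ s, |a k| ^ q) ^ (1 / q) ≤ ‖∑ k ∈ s, a k • x k‖ ∧
      ‖∑ k ∈ s, a k • x k‖ ≤ K * (∑ k ∈ s, |a k| ^ q) ^ (1 / q)

/-- `x` is `K`-equivalent to the usual `ℓ^q_n` basis. -/
def IsLqBasisEquivFin (q K : ℝ) {n : ℕ} (x : Fin n → E) : Prop :=
  ∀ a : Fin n → ℝ,
    (1 / K) * (∑ k, |a k| ^ q) ^ (1 / q) ≤ ‖∑ k, a k • x k‖ ∧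
      ‖∑ k, a k • x k‖ ≤ K * (∑ k, |a k| ^ q) ^ (1 / q)

/-- `x` is `u`-unconditional. -/
def IsUnconditionalWith (u : ℝ) (x : ℕ → E) : Prop :=
  ∀ (s : Finset ℕ) (c ε : ℕ → ℝ), (∀ k ∈ s, |ε k| = 1) →
    ‖∑ k ∈ s, (ε k * c k) • x k‖ ≤ u * ‖∑ k ∈ s, c k • x k‖

/-- `x` is unconditional. -/
def IsUnconditional (x : ℕ → E) : Prop :=
  ∃ u : ℝ, 1 ≤ u ∧ IsUnconditionalWith u x

/-- Finite version of `u`-unconditionality. -/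
def IsUnconditionalWithFin (u : ℝ) {n : ℕ} (x : Fin n → E) : Prop :=
  ∀ (c ε : Fin n → ℝ), (∀ k, |ε k| = 1) →
    ‖∑ k, (ε k * c k) • x k‖ ≤ u * ‖∑ k, c k • x k‖

/-- The measure `μ` is atomless: every measurable set of positive measure contains a
measurable subset of strictly smaller positive measure. -/
def Atomless {Ω : Type*} [MeasurableSpace Ω] (μ : Measure Ω) : Prop :=
  ∀ A : Set Ω, MeasurableSet A → 0 < μ A →
    ∃ B, B ⊆ A ∧ MeasurableSet B ∧ 0 < μ B ∧ μ B < μ A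

/-- The family `(|f n|^p)` is uniformly integrable. -/
def UnifIntPow {Ω : Type*} [MeasurableSpace Ω] (μ : Measure Ω) (p : ℝ) (f : ℕ → Ω → ℝ) : Prop :=
  ∀ ε : ℝ, 0 < ε → ∃ δ : ℝ, 0 < δ ∧ ∀ n, ∀ A : Set Ω, MeasurableSet A →
    μ A ≤ ENNReal.ofReal δ → ∫ x in A, |f n x| ^ p ∂μ ≤ ε

/-- `(f n)` is weakly null in `L^p(μ)`. -/
def WeaklyNullLp {Ω : Type*} [MeasurableSpace Ω] (μ : Measure Ω) (p : ℝ≥0∞)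
    (f : ℕ → Lp ℝ p μ) : Prop :=
  ∀ q : ℝ≥0∞, p⁻¹ + q⁻¹ = 1 → ∀ g : Lp ℝ q μ,
    Tendsto (fun n => ∫ x, (f n : Ω → ℝ) x * (g : Ω → ℝ) x ∂μ) atTop (nhds 0)

/-- The `p`-modulus of uniform integrability. -/
def omegaP {Ω : Type*} [MeasurableSpace Ω] (μ : Measure Ω) (p : ℝ) (f : Ω → ℝ) (ε : ℝ) : ℝ :=
  sSup {r : ℝ | ∃ A : Set Ω, MeasurableSet A ∧ μ A ≤ ENNReal.ofReal ε ∧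
    r = (∫ x in A, |f x| ^ p ∂μ) ^ (1 / p)}


/-- The sign vector attached to a finite set `t`: `1` on `t` and `-1` off `t`. -/
def finsetSign (t : Finset ℕ) (i : ℕ) : ℝ := if i ∈ t then 1 else -1

lemma abs_finsetSign (t : Finset ℕ) (i : ℕ) : |finsetSign t i| = 1 := by
  unfold finsetSign; split_ifs <;> simp

lemma finsetSign_mul_self (t : Finset ℕ) (i : ℕ) : finsetSign t i * finsetSign t i = 1 := by
  unfold finsetSign; split_ifs <;> simp

/-- Parseval's identity for random signs, with a constant term. -/
lemma sum_powerset_add_sum_finsetSign_sq (s : Finset ℕ) (a : ℕ → ℝ) (b : ℝ) :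
    ∑ t ∈ s.powerset, (b + ∑ i ∈ s, finsetSign t i * a i) ^ 2 =
      2 ^ s.card * (b ^ 2 + ∑ i ∈ s, a i ^ 2) := by
  induction s using Finset.induction_on generalizing b with
  | empty => simp
  | insert j s hj ih =>
    have h1 : ∀ t ∈ s.powerset, (b + ∑ i ∈ insert j s, finsetSign t i * a i) ^ 2 =
        ((b - a j) + ∑ i ∈ s, finsetSign t i * a i) ^ 2 := by
      intro t ht
      have hjt : j ∉ t := fun h => hj (Finset.mem_powerset.1 ht h)
      rw [Finset.sum_insert hj]
      simp only [finsetSign, if_neg hjt]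
      ring
    have h2 : ∀ t ∈ s.powerset,
        (b + ∑ i ∈ insert j s, finsetSign (insert j t) i * a i) ^ 2 =
        ((b + a j) + ∑ i ∈ s, finsetSign t i * a i) ^ 2 := by
      intro t _
      have h3 : ∑ i ∈ s, finsetSign (insert j t) i * a i = ∑ i ∈ s, finsetSign t i * a i := by
        refine Finset.sum_congr rfl fun i hi => ?_
        have hij : i ≠ j := fun h => hj (h ▸ hi)
        simp [finsetSign, hij]
      rw [Finset.sum_insert hj, h3]
      simp only [finsetSign, Finset.mem_insert_self, if_true]
      ring
    rw [Finset.sum_powerset_insert hj, Finset.sum_congr rfl h1, Finset.sum_congr rfl h2, ih, ih,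
      Finset.sum_insert hj, Finset.card_insert_of_notMem hj]
    ring

/-- The upper Khintchine inequality for exponents `p ≤ 2`. -/
lemma sum_powerset_abs_rpow_le {p : ℝ} (hp0 : 0 < p) (hp2 : p ≤ 2) (s : Finset ℕ) (a : ℕ → ℝ) :
    ∑ t ∈ s.powerset, |∑ i ∈ s, finsetSign t i * a i| ^ p ≤
      2 ^ s.card * (∑ i ∈ s, a i ^ 2) ^ (p / 2) := by
  have hN : (0 : ℝ) < 2 ^ s.card := by positivity
  have h := Real.arith_mean_le_rpow_mean s.powerset (fun _ => ((2 : ℝ) ^ s.card)⁻¹)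
    (fun t => |∑ i ∈ s, finsetSign t i * a i| ^ p) (fun _ _ => by positivity)
    (by simp [Finset.card_powerset]) (fun _ _ => by positivity)
    (p := 2 / p) (by rwa [le_div_iff₀ hp0, one_mul])
  have hsq : ∀ t ∈ s.powerset, ((2 : ℝ) ^ s.card)⁻¹ *
      (|∑ i ∈ s, finsetSign t i * a i| ^ p) ^ (2 / p) =
      ((2 : ℝ) ^ s.card)⁻¹ * (0 + ∑ i ∈ s, finsetSign t i * a i) ^ 2 := by
    intro t _
    rw [← Real.rpow_mul (abs_nonneg _), mul_div_cancel₀ _ hp0.ne', Real.rpow_two, sq_abs, zero_add]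
  rw [Finset.sum_congr rfl hsq, ← Finset.mul_sum, ← Finset.mul_sum,
    sum_powerset_add_sum_finsetSign_sq, inv_mul_cancel_left₀ hN.ne', one_div_div] at h
  rw [inv_mul_le_iff₀ hN] at h
  simpa using h

lemma add_rpow_le_rpow_add_rpow {q x y : ℝ} (hq0 : 0 ≤ q) (hq1 : q ≤ 1) (hx : 0 ≤ x)
    (hy : 0 ≤ y) : (x + y) ^ q ≤ x ^ q + y ^ q := by
  lift x to ℝ≥0 using hx
  lift y to ℝ≥0 using hy
  exact_mod_cast NNReal.rpow_add_le_add_rpow x y hq0 hq1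

lemma rpow_sum_le_sum_rpow_of_le_one {q : ℝ} (hq0 : 0 < q) (hq1 : q ≤ 1) (s : Finset ℕ)
    {b : ℕ → ℝ} (hb : ∀ i, 0 ≤ b i) : (∑ i ∈ s, b i) ^ q ≤ ∑ i ∈ s, b i ^ q := by
  induction s using Finset.induction_on with
  | empty => simp [Real.zero_rpow hq0.ne']
  | insert j s hj ih =>
    rw [Finset.sum_insert hj, Finset.sum_insert hj]
    exact (add_rpow_le_rpow_add_rpow hq0.le hq1 (hb j) (Finset.sum_nonneg fun i _ => hb i)).trans
      (by gcongr)

/-- Truncating each coordinate at level `T` controls the square function. -/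
lemma rpow_sum_sq_le_truncation {p : ℝ} (hp0 : 0 < p) (hp2 : p ≤ 2) {T : ℝ} (hT : 0 ≤ T)
    (s : Finset ℕ) (a : ℕ → ℝ) :
    (∑ i ∈ s, a i ^ 2) ^ (p / 2) ≤
      (s.card : ℝ) ^ (p / 2) * T + ∑ i ∈ s, if T ≤ |a i| ^ p then |a i| ^ p else 0 := by
  have hpow : ∀ x : ℝ, (x ^ 2) ^ (p / 2) = |x| ^ p := by
    intro x
    rw [← sq_abs, ← Real.rpow_two, ← Real.rpow_mul (abs_nonneg _), mul_div_cancel₀ _ two_ne_zero]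
  set b : ℕ → ℝ := fun i => if T ≤ |a i| ^ p then a i ^ 2 else 0 with hb
  have hb0 : ∀ i, 0 ≤ b i := fun i => by simp only [hb]; split_ifs <;> positivity
  have hle : ∀ i, a i ^ 2 ≤ T ^ (2 / p) + b i := by
    intro i
    simp only [hb]
    split_ifs with h
    · have : 0 ≤ T ^ (2 / p) := by positivity
      linarith
    · have h1 : (|a i| ^ p) ^ (2 / p) ≤ T ^ (2 / p) :=
        Real.rpow_le_rpow (by positivity) (not_le.1 h).le (by positivity)
      rw [← Real.rpow_mul (abs_nonneg _), mul_div_cancel₀ _ hp0.ne', Real.rpow_two, sq_abs] at h1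
      linarith
  have hq : p / 2 ≤ 1 := by linarith
  calc (∑ i ∈ s, a i ^ 2) ^ (p / 2)
      ≤ ((s.card : ℝ) * T ^ (2 / p) + ∑ i ∈ s, b i) ^ (p / 2) := by
        refine Real.rpow_le_rpow (Finset.sum_nonneg fun i _ => sq_nonneg _) ?_ (by positivity)
        refine (Finset.sum_le_sum fun i _ => hle i).trans_eq ?_
        simp [Finset.sum_add_distrib]
    _ ≤ ((s.card : ℝ) * T ^ (2 / p)) ^ (p / 2) + (∑ i ∈ s, b i) ^ (p / 2) :=
        add_rpow_le_rpow_add_rpow (by positivity) hq (by positivity)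
          (Finset.sum_nonneg fun i _ => hb0 i)
    _ ≤ (s.card : ℝ) ^ (p / 2) * T + ∑ i ∈ s, if T ≤ |a i| ^ p then |a i| ^ p else 0 := by
        gcongr ?_ + ?_
        · rw [Real.mul_rpow (by positivity) (by positivity), ← Real.rpow_mul hT,
            div_mul_div_cancel₀ hp0.ne', div_self two_ne_zero, Real.rpow_one]
        · refine (rpow_sum_le_sum_rpow_of_le_one (by positivity) hq s hb0).trans_eq ?_
          refine Finset.sum_congr rfl fun i _ => ?_
          simp only [hb]
          split_ifs
          · exact hpow _
          · exact Real.zero_rpow (by positivity)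

section Lp

variable {Ω : Type*} [MeasurableSpace Ω] {μ : Measure Ω} {p : ℝ}

lemma integrable_abs_rpow_coeFn (hp : 1 ≤ p) (g : Lp ℝ (ENNReal.ofReal p) μ) :
    Integrable (fun x => |g x| ^ p) μ := by
  have hp0 : 0 < p := by linarith
  have h := (Lp.memLp g).integrable_norm_rpow (by simpa using hp0) ENNReal.ofReal_ne_top
  simpa [ENNReal.toReal_ofReal hp0.le] using h

lemma norm_rpow_eq_integral (hp : 1 ≤ p) (g : Lp ℝ (ENNReal.ofReal p) μ) :
    ‖g‖ ^ p = ∫ x, |g x| ^ p ∂μ := by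
  have hp0 : 0 < p := by linarith
  have h0 : 0 ≤ ∫ x, |g x| ^ p ∂μ := integral_nonneg fun x => by positivity
  rw [Lp.norm_def, (Lp.memLp g).eLpNorm_eq_integral_rpow_norm (by simpa using hp0)
    ENNReal.ofReal_ne_top, ENNReal.toReal_ofReal hp0.le]
  simp only [Real.norm_eq_abs]
  rw [ENNReal.toReal_ofReal (by positivity), ← Real.rpow_mul h0, inv_mul_cancel₀ hp0.ne',
    Real.rpow_one]

lemma measurableSet_le_abs_rpow_coeFn (g : Lp ℝ (ENNReal.ofReal p) μ) (T : ℝ) :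
    MeasurableSet {x | T ≤ |g x| ^ p} := by
  have hg : Measurable (g : Ω → ℝ) := (Lp.stronglyMeasurable g).measurable
  exact measurableSet_le measurable_const (hg.abs.pow_const p)

lemma norm_sum_rpow_le_of_unconditional [Fact (1 ≤ ENNReal.ofReal p)] (hp1 : 1 ≤ p)
    (hp2 : p ≤ 2) {f : ℕ → Lp ℝ (ENNReal.ofReal p) μ} [IsProbabilityMeasure μ] {u : ℝ}
    (hu : 1 ≤ u) (hf : IsUnconditionalWith u f) {T : ℝ} (hT : 0 ≤ T) (s : Finset ℕ) :
    ‖∑ i ∈ s, f i‖ ^ p ≤ u ^ p * ((s.card : ℝ) ^ (p / 2) * T +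
      ∑ i ∈ s, ∫ x in {x | T ≤ |f i x| ^ p}, |f i x| ^ p ∂μ) := by
  have hp0 : 0 < p := by linarith
  have hN : (0 : ℝ) < 2 ^ s.card := by positivity
  have hsign : ∀ t : Finset ℕ, ‖∑ i ∈ s, f i‖ ^ p ≤
      u ^ p * ‖∑ i ∈ s, finsetSign t i • f i‖ ^ p := by
    intro t
    have h := hf s (finsetSign t) (finsetSign t) fun i _ => abs_finsetSign t i
    simp only [finsetSign_mul_self, one_smul] at h
    rw [← Real.mul_rpow (by linarith) (norm_nonneg _)]
    exact Real.rpow_le_rpow (norm_nonneg _) h hp0.le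
  have hcoe : ∀ t : Finset ℕ, ∀ᵐ x ∂μ, (∑ i ∈ s, finsetSign t i • f i : Lp ℝ _ μ) x =
      ∑ i ∈ s, finsetSign t i * f i x := by
    intro t
    have h2 : ∀ᵐ x ∂μ, ∀ i, (finsetSign t i • f i : Lp ℝ _ μ) x = finsetSign t i * f i x :=
      ae_all_iff.2 fun i => Lp.coeFn_smul (finsetSign t i) (f i)
    filter_upwards [Lp.coeFn_finsetSum s fun i => finsetSign t i • f i, h2] with x h1 h2
    rw [h1]
    simp [h2]
  have hint : ∀ t : Finset ℕ,
      Integrable (fun x => |(∑ i ∈ s, finsetSign t i • f i : Lp ℝ _ μ) x| ^ p) μ :=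
    fun t => integrable_abs_rpow_coeFn hp1 _
  have hind : ∀ i, Integrable (fun x => if T ≤ |f i x| ^ p then |f i x| ^ p else 0) μ := fun i =>
    (integrable_abs_rpow_coeFn hp1 (f i)).indicator (measurableSet_le_abs_rpow_coeFn (f i) T)
  have havg : ∑ t ∈ s.powerset, ‖∑ i ∈ s, finsetSign t i • f i‖ ^ p ≤
      2 ^ s.card * ((s.card : ℝ) ^ (p / 2) * T +
        ∑ i ∈ s, ∫ x in {x | T ≤ |f i x| ^ p}, |f i x| ^ p ∂μ) := by
    have hrhs : ∫ x, (2 : ℝ) ^ s.card * ((s.card : ℝ) ^ (p / 2) * T +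
        ∑ i ∈ s, if T ≤ |f i x| ^ p then |f i x| ^ p else 0) ∂μ =
        2 ^ s.card * ((s.card : ℝ) ^ (p / 2) * T +
        ∑ i ∈ s, ∫ x in {x | T ≤ |f i x| ^ p}, |f i x| ^ p ∂μ) := by
      rw [integral_const_mul, integral_add (integrable_const _)
        (integrable_finsetSum _ fun i _ => hind i), integral_finsetSum _ fun i _ => hind i]
      simp only [integral_const, probReal_univ, one_smul]
      congr 2
      refine Finset.sum_congr rfl fun i _ => ?_
      rw [← integral_indicator (measurableSet_le_abs_rpow_coeFn (f i) T)]
      rfl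
    simp only [norm_rpow_eq_integral hp1]
    rw [← hrhs, ← integral_finsetSum _ fun t _ => hint t]
    refine integral_mono_ae (integrable_finsetSum _ fun t _ => hint t)
      (((integrable_const _).add (integrable_finsetSum _ fun i _ => hind i)).const_mul _) ?_
    filter_upwards [(ae_ball_iff s.powerset.countable_toSet).2 fun t _ => hcoe t] with x hx
    have h1 : ∑ t ∈ s.powerset, |(∑ i ∈ s, finsetSign t i • f i : Lp ℝ _ μ) x| ^ p =
        ∑ t ∈ s.powerset, |∑ i ∈ s, finsetSign t i * f i x| ^ p :=
      Finset.sum_congr rfl fun t ht => by rw [hx t ht]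
    refine h1.trans_le ((sum_powerset_abs_rpow_le hp0 hp2 s fun i => f i x).trans ?_)
    gcongr
    exact rpow_sum_sq_le_truncation hp0 hp2 hT s fun i => f i x
  have hsum : (2 : ℝ) ^ s.card * ‖∑ i ∈ s, f i‖ ^ p ≤
      u ^ p * ∑ t ∈ s.powerset, ‖∑ i ∈ s, finsetSign t i • f i‖ ^ p := by
    rw [Finset.mul_sum]
    refine le_of_eq_of_le ?_ (Finset.sum_le_sum fun t _ => hsign t)
    simp [Finset.card_powerset]
  refine le_of_mul_le_mul_left ?_ hN
  calc _ ≤ _ := hsum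
    _ ≤ _ := mul_le_mul_of_nonneg_left havg (by positivity)
    _ = _ := by ring

/-- Bounded `p`-uniformly integrable sequences have uniformly small tails. -/
lemma exists_forall_setIntegral_tail_le [IsProbabilityMeasure μ] [Fact (1 ≤ ENNReal.ofReal p)]
    (hp1 : 1 ≤ p)
    {f : ℕ → Lp ℝ (ENNReal.ofReal p) μ} {M : ℝ} (hM : ∀ n, ‖f n‖ ≤ M)
    (hui : UnifIntPow μ p fun n => (f n : Ω → ℝ)) {ε : ℝ} (hε : 0 < ε) :
    ∃ T : ℝ, 0 ≤ T ∧ ∀ n, ∫ x in {x | T ≤ |f n x| ^ p}, |f n x| ^ p ∂μ ≤ ε := by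
  obtain ⟨δ, hδ, h⟩ := hui ε hε
  have hM0 : 0 ≤ M := (norm_nonneg _).trans (hM 0)
  have hT : 0 < (M ^ p + 1) / δ := by positivity
  refine ⟨(M ^ p + 1) / δ, hT.le, fun n => h n _ (measurableSet_le_abs_rpow_coeFn (f n) _) ?_⟩
  have hmark := mul_meas_ge_le_integral_of_nonneg
    (ae_of_all _ fun x => by positivity) (integrable_abs_rpow_coeFn hp1 (f n)) ((M ^ p + 1) / δ)
  rw [← norm_rpow_eq_integral hp1] at hmark
  have hn : ‖f n‖ ^ p ≤ M ^ p := Real.rpow_le_rpow (norm_nonneg _) (hM n) (by linarith)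
  rw [← ofReal_measureReal]
  refine ENNReal.ofReal_le_ofReal (le_of_mul_le_mul_left ?_ hT)
  rw [div_mul_cancel₀ _ hδ.ne']
  linarith

end Lp

/-- (Commutative case of Lemma 3.1.) -/
theorem statement3
    {Ω : Type*} [MeasurableSpace Ω] (μ : Measure Ω) [IsProbabilityMeasure μ]
    (hμ : Atomless μ)
    (p : ℝ) (hp1 : 1 ≤ p) (hp2 : p < 2)
    [Fact (1 ≤ ENNReal.ofReal p)]
    (f : ℕ → Lp ℝ (ENNReal.ofReal p) μ)
    (M : ℝ) (hM : ∀ n, ‖f n‖ ≤ M)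
    (huncond : IsUnconditional f)
    (hui : UnifIntPow μ p fun n => (f n : Ω → ℝ)) :
    Tendsto (fun n : ℕ => (n : ℝ) ^ (-(1 / p)) * ‖∑ i ∈ Finset.range n, f i‖)
      atTop (nhds 0) := by
  obtain ⟨u, hu, hf⟩ := huncond
  have hp0 : 0 < p := by linarith
  have hlim : Tendsto (fun n : ℕ => (n : ℝ)⁻¹ * ‖∑ i ∈ Finset.range n, f i‖ ^ p) atTop
      (nhds 0) := by
    rw [Metric.tendsto_atTop]
    intro η hη
    have hup : 0 < u ^ p := by positivity
    obtain ⟨T, hT, htail⟩ := exists_forall_setIntegral_tail_le hp1 hM hui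
      (ε := η / (2 * u ^ p)) (by positivity)
    have hdecay : Tendsto (fun n : ℕ => u ^ p * ((n : ℝ) ^ (-(1 - p / 2)) * T)) atTop
        (nhds 0) := by
      simpa using (((tendsto_rpow_neg_atTop (show 0 < 1 - p / 2 by linarith)).comp
        tendsto_natCast_atTop_atTop).mul_const T).const_mul (u ^ p)
    obtain ⟨N, hN⟩ := eventually_atTop.1
      ((hdecay.eventually_lt_const (half_pos hη)).and (eventually_gt_atTop 0))
    refine ⟨N, fun n hn => ?_⟩
    obtain ⟨hn1, hn0⟩ := hN n hn
    have hn0' : (0 : ℝ) < n := by exact_mod_cast hn0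
    rw [Real.dist_0_eq_abs, abs_of_nonneg (by positivity), inv_mul_lt_iff₀ hn0']
    have hsum : ∑ i ∈ Finset.range n, ∫ x in {x | T ≤ |f i x| ^ p}, |f i x| ^ p ∂μ ≤
        n * (η / (2 * u ^ p)) := by
      refine (Finset.sum_le_sum fun i _ => htail i).trans_eq ?_
      simp
    have hpow : (n : ℝ) ^ (p / 2) = n * (n : ℝ) ^ (-(1 - p / 2)) := by
      rw [← Real.rpow_one_add' hn0'.le (by linarith)]
      congr 1
      ring
    calc ‖∑ i ∈ Finset.range n, f i‖ ^ p
        ≤ u ^ p * ((n : ℝ) ^ (p / 2) * T +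
          ∑ i ∈ Finset.range n, ∫ x in {x | T ≤ |f i x| ^ p}, |f i x| ^ p ∂μ) := by
          simpa using norm_sum_rpow_le_of_unconditional hp1 hp2.le hu hf hT (Finset.range n)
      _ ≤ u ^ p * ((n : ℝ) ^ (p / 2) * T + n * (η / (2 * u ^ p))) := by gcongr
      _ = n * (u ^ p * ((n : ℝ) ^ (-(1 - p / 2)) * T) + η / 2) := by
          rw [hpow]
          field_simp
      _ < n * η := by
          gcongr
          linarith
  have hroot := hlim.rpow_const (p := 1 / p) (Or.inr (by positivity))
  rw [Real.zero_rpow (by positivity)] at hroot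
  refine hroot.congr fun n => ?_
  rw [Real.mul_rpow (by positivity) (by positivity), ← Real.rpow_mul (norm_nonneg _),
    mul_one_div_cancel hp0.ne', Real.rpow_one, Real.inv_rpow (by positivity),
    Real.rpow_neg (by positivity)]

end
end

section
/- (Commutative case of Lemma 3.2.) Let u ≥ 1, δ > 0, 1 ≤ p < 2, let (Ω, μ) be a probability space, and let f_1, …, f_n ∈ L^p(μ) with ‖f_i‖_{L^p(μ)} ≤ 1 for all i, such that (f_1, …, f_n) is u-unconditional. Assume there exist pairwise disjoint measurable sets A_1, …, A_n ⊆ Ω such that ∫_{A_j} |f_j|^p dμ ≥ δ^p for all 1 ≤ j ≤ n. Then (f_1, …, f_n) is C-equivalent to the usual ℓ^p_n basis, where C = u·√3·δ^{-1}. -/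
open MeasureTheory Filter
open scoped ENNReal NNReal BigOperators

noncomputable section

variable {E : Type*} [NormedAddCommGroup E] [NormedSpace ℝ E]

theorem abs_sub_rpow_le {p : ℝ} (hp : 1 ≤ p) (x y : ℝ) :
    |x - y| ^ p ≤ 2 ^ (p - 1) * (|x| ^ p + |y| ^ p) := by
  have h := NNReal.rpow_add_le_mul_rpow_add_rpow (Real.nnabs x) (Real.nnabs y) hp
  have h' : (|x| + |y|) ^ p ≤ 2 ^ (p - 1) * (|x| ^ p + |y| ^ p) := by exact_mod_cast h
  exact (Real.rpow_le_rpow (abs_nonneg _) (abs_sub x y) (by linarith)).trans h'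

theorem abs_add_rpow_add_abs_sub_rpow_le {p : ℝ} (hp0 : 0 ≤ p) (hp2 : p ≤ 2) (x y : ℝ) :
    |x + y| ^ p + |x - y| ^ p ≤ 2 * (|x| ^ p + |y| ^ p) := by
  have habs (t : ℝ) : |t| ^ p = (t ^ 2) ^ (p / 2) := by
    rw [← sq_abs, ← Real.rpow_natCast, ← Real.rpow_mul (abs_nonneg t)]
    congr 1
    push_cast
    ring
  simp only [habs]
  have hconc := (Real.concaveOn_rpow (p := p / 2) (by linarith) (by linarith)).2
    (Set.mem_Ici.2 (sq_nonneg (x + y))) (Set.mem_Ici.2 (sq_nonneg (x - y)))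
    (by norm_num : (0 : ℝ) ≤ 1 / 2) (by norm_num : (0 : ℝ) ≤ 1 / 2) (by norm_num)
  simp only [smul_eq_mul] at hconc
  rw [show 1 / 2 * (x + y) ^ 2 + 1 / 2 * (x - y) ^ 2 = x ^ 2 + y ^ 2 by ring] at hconc
  have hsub := Real.rpow_add_le_add_rpow (sq_nonneg x) (sq_nonneg y)
    (p := p / 2) (by linarith) (by linarith)
  linarith

/-- In a normed space satisfying a two-point inequality of type `p`, suitable signs make the norm
of a signed sum at most the `ℓ^p` sum of the norms. -/
theorem exists_signs_norm_sum_rpow_le {F ι : Type*} [NormedAddCommGroup F] [NormedSpace ℝ F]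
    {p : ℝ} (hp : 0 < p)
    (htype : ∀ x y : F, ‖x + y‖ ^ p + ‖x - y‖ ^ p ≤ 2 * (‖x‖ ^ p + ‖y‖ ^ p))
    (g : ι → F) (s : Finset ι) :
    ∃ ε : ι → ℝ, (∀ k, |ε k| = 1) ∧ ‖∑ k ∈ s, ε k • g k‖ ^ p ≤ ∑ k ∈ s, ‖g k‖ ^ p := by
  classical
  induction s using Finset.induction_on with
  | empty => exact ⟨fun _ => 1, by simp, by simp [Real.zero_rpow hp.ne']⟩
  | insert i s hi ih =>
    obtain ⟨ε, hε, hle⟩ := ih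
    have hsum (t : ℝ) : ∑ k ∈ insert i s, Function.update ε i t k • g k =
        t • g i + ∑ k ∈ s, ε k • g k := by
      rw [Finset.sum_insert hi, Function.update_self]
      congr 1
      refine Finset.sum_congr rfl fun k hk => ?_
      rw [Function.update_of_ne (ne_of_mem_of_not_mem hk hi)]
    have hsign (t : ℝ) (ht : |t| = 1) (k : ι) : |Function.update ε i t k| = 1 := by
      by_cases hk : k = i
      · subst hk
        simpa using ht
      · rw [Function.update_of_ne hk, hε]
    have htwo := htype (∑ k ∈ s, ε k • g k) (g i)
    by_cases h : ‖∑ k ∈ s, ε k • g k + g i‖ ^ p ≤ ‖∑ k ∈ s, ε k • g k - g i‖ ^ p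
    · refine ⟨Function.update ε i 1, hsign 1 (by simp), ?_⟩
      rw [hsum, Finset.sum_insert hi, one_smul, add_comm (g i)]
      linarith
    · refine ⟨Function.update ε i (-1), hsign (-1) (by simp), ?_⟩
      rw [hsum, Finset.sum_insert hi, neg_one_smul, neg_add_eq_sub]
      linarith

/-- Averaging over signs dominates each single term, for a `p`-homogeneous function that is
convex in the weak sense of `hsub`. -/
theorem card_mul_le_sum_signs {F ι : Type*} [AddCommGroup F] [Module ℝ F]
    [Fintype ι] [DecidableEq ι] {p : ℝ} (φ : F → ℝ)
    (hsub : ∀ x y, φ (x - y) ≤ 2 ^ (p - 1) * (φ x + φ y))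
    (hsmul : ∀ (c : ℝ) x, φ (c • x) = |c| ^ p * φ x) (g : ι → F) (j : ι) :
    (Fintype.card (ι → ℤˣ) : ℝ) * φ (g j) ≤
      ∑ σ : ι → ℤˣ, φ (∑ k, ((σ k : ℤ) : ℝ) • g k) := by
  let G : (ι → ℤˣ) → F := fun σ => ∑ k, ((σ k : ℤ) : ℝ) • g k
  let τ : ι → ℤˣ := Pi.mulSingle j (-1)
  have hdiff (σ : ι → ℤˣ) : G σ - G (σ * τ) = (2 * ((σ j : ℤ) : ℝ)) • g j := by
    simp only [G, ← Finset.sum_sub_distrib, ← sub_smul]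
    rw [Finset.sum_eq_single j]
    · congr 1
      simp [τ]
      ring
    · intro k _ hk
      simp [τ, Pi.mulSingle_eq_of_ne hk]
    · simp
  have habs (σ : ι → ℤˣ) : |2 * ((σ j : ℤ) : ℝ)| = 2 := by
    rcases Int.units_eq_one_or (σ j) with h | h <;> simp [h]
  have hpair (σ : ι → ℤˣ) : 2 * φ (g j) ≤ φ (G σ) + φ (G (σ * τ)) := by
    have h := hsub (G σ) (G (σ * τ))
    rw [hdiff, hsmul, habs] at h
    have h2 : (2 : ℝ) ^ p = 2 ^ (p - 1) * 2 := by
      rw [Real.rpow_sub_one two_ne_zero]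
      ring
    rw [h2, mul_assoc] at h
    exact le_of_mul_le_mul_left h (by positivity)
  have hflip : ∑ σ, φ (G (σ * τ)) = ∑ σ, φ (G σ) :=
    Equiv.sum_comp (Equiv.mulRight τ) fun σ => φ (G σ)
  have h := Finset.sum_le_sum fun σ (_ : σ ∈ Finset.univ) => hpair σ
  rw [Finset.sum_add_distrib, hflip, Finset.sum_const, Finset.card_univ, nsmul_eq_mul] at h
  change _ ≤ ∑ σ, φ (G σ)
  linarith

section LpReal

variable {Ω : Type*} [MeasurableSpace Ω] {μ : Measure Ω} {p : ℝ}

theorem integrable_abs_rpow_Lp (hp : 1 ≤ p) (g : Lp ℝ (ENNReal.ofReal p) μ) :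
    Integrable (fun x => |(g : Ω → ℝ) x| ^ p) μ := by
  have h := (Lp.memLp g).integrable_norm_rpow (by simp; linarith) ENNReal.ofReal_ne_top
  rwa [ENNReal.toReal_ofReal (by linarith)] at h

theorem Lp_norm_rpow_eq_integral (hp : 1 ≤ p) (g : Lp ℝ (ENNReal.ofReal p) μ) :
    ‖g‖ ^ p = ∫ x, |(g : Ω → ℝ) x| ^ p ∂μ := by
  have hnonneg : 0 ≤ ∫ x, |(g : Ω → ℝ) x| ^ p ∂μ := integral_nonneg fun x => by positivity
  rw [Lp.norm_def, (Lp.memLp g).eLpNorm_eq_integral_rpow_norm (by simp; linarith)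
    ENNReal.ofReal_ne_top, ENNReal.toReal_ofReal (by positivity),
    ENNReal.toReal_ofReal (by linarith)]
  exact Real.rpow_inv_rpow hnonneg (by linarith)

theorem Lp_norm_add_rpow_add_norm_sub_rpow_le (hp1 : 1 ≤ p) (hp2 : p ≤ 2)
    (g h : Lp ℝ (ENNReal.ofReal p) μ) :
    ‖g + h‖ ^ p + ‖g - h‖ ^ p ≤ 2 * (‖g‖ ^ p + ‖h‖ ^ p) := by
  have hi := integrable_abs_rpow_Lp (μ := μ) hp1
  simp only [Lp_norm_rpow_eq_integral hp1]
  rw [← integral_add (hi _) (hi _), ← integral_add (hi _) (hi _), ← integral_const_mul]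
  refine integral_mono_ae ((hi _).add (hi _)) (((hi _).add (hi _)).const_mul 2) ?_
  filter_upwards [Lp.coeFn_add g h, Lp.coeFn_sub g h] with x hadd hsub
  simp only [hadd, hsub, Pi.add_apply, Pi.sub_apply]
  exact abs_add_rpow_add_abs_sub_rpow_le (by linarith) hp2 _ _

theorem setIntegral_abs_sub_rpow_le (hp : 1 ≤ p) (B : Set Ω) (g h : Lp ℝ (ENNReal.ofReal p) μ) :
    ∫ x in B, |((g - h : Lp ℝ (ENNReal.ofReal p) μ) : Ω → ℝ) x| ^ p ∂μ ≤
      2 ^ (p - 1) * (∫ x in B, |(g : Ω → ℝ) x| ^ p ∂μ + ∫ x in B, |(h : Ω → ℝ) x| ^ p ∂μ) := by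
  have hi (g : Lp ℝ (ENNReal.ofReal p) μ) := (integrable_abs_rpow_Lp hp g).restrict (s := B)
  rw [← integral_add (hi _) (hi _), ← integral_const_mul]
  refine integral_mono_ae (hi _) (((hi _).add (hi _)).const_mul _) ?_
  filter_upwards [ae_restrict_of_ae (Lp.coeFn_sub g h)] with x hsub
  simp only [hsub, Pi.sub_apply]
  exact abs_sub_rpow_le hp _ _

theorem setIntegral_abs_smul_rpow (B : Set Ω) (c : ℝ) (g : Lp ℝ (ENNReal.ofReal p) μ) :
    ∫ x in B, |((c • g : Lp ℝ (ENNReal.ofReal p) μ) : Ω → ℝ) x| ^ p ∂μ =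
      |c| ^ p * ∫ x in B, |(g : Ω → ℝ) x| ^ p ∂μ := by
  rw [← integral_const_mul]
  refine integral_congr_ae ?_
  filter_upwards [ae_restrict_of_ae (Lp.coeFn_smul c g)] with x hx
  simp only [hx, Pi.smul_apply, smul_eq_mul, abs_mul,
    Real.mul_rpow (abs_nonneg _) (abs_nonneg _)]

theorem sum_setIntegral_abs_rpow_le {ι : Type*} [Fintype ι] (hp : 1 ≤ p) {A : ι → Set Ω}
    (hmeas : ∀ i, MeasurableSet (A i)) (hdisj : Pairwise (Function.onFun Disjoint A))
    (g : Lp ℝ (ENNReal.ofReal p) μ) :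
    ∑ j, ∫ x in A j, |(g : Ω → ℝ) x| ^ p ∂μ ≤ ‖g‖ ^ p := by
  have hi := integrable_abs_rpow_Lp hp g
  rw [← integral_iUnion_fintype hmeas hdisj fun i => hi.integrableOn,
    Lp_norm_rpow_eq_integral hp]
  exact setIntegral_le_integral hi (ae_of_all _ fun x => by positivity)

end LpReal

theorem IsUnconditionalWithFin.norm_sum_le {u : ℝ} {n : ℕ} {x : Fin n → E}
    (h : IsUnconditionalWithFin u x) (c ε : Fin n → ℝ) (hε : ∀ k, |ε k| = 1) :
    ‖∑ k, c k • x k‖ ≤ u * ‖∑ k, (ε k * c k) • x k‖ := by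
  have h' := h (fun k => ε k * c k) ε hε
  have hsq (k : Fin n) : ε k * (ε k * c k) = c k := by
    rw [← mul_assoc, ← abs_mul_abs_self, hε, one_mul, one_mul]
  simpa only [hsq] using h'

theorem norm_sum_smul_le_of_unconditional {Ω : Type*} [MeasurableSpace Ω] {μ : Measure Ω}
    {u p : ℝ} (hu : 0 ≤ u) (hp1 : 1 ≤ p) (hp2 : p ≤ 2) [Fact (1 ≤ ENNReal.ofReal p)]
    {n : ℕ} {f : Fin n → Lp ℝ (ENNReal.ofReal p) μ} (hf : ∀ i, ‖f i‖ ≤ 1)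
    (huncond : IsUnconditionalWithFin u f) (a : Fin n → ℝ) :
    ‖∑ k, a k • f k‖ ≤ u * (∑ k, |a k| ^ p) ^ (1 / p) := by
  have hp0 : 0 < p := by linarith
  obtain ⟨ε, hε, hle⟩ := exists_signs_norm_sum_rpow_le hp0
    (Lp_norm_add_rpow_add_norm_sub_rpow_le hp1 hp2) (fun k => a k • f k) Finset.univ
  simp only [smul_smul] at hle
  refine (huncond.norm_sum_le a ε hε).trans (mul_le_mul_of_nonneg_left ?_ hu)
  rw [one_div, Real.le_rpow_inv_iff_of_pos (norm_nonneg _)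
    (Finset.sum_nonneg fun k _ => by positivity) hp0]
  refine hle.trans (Finset.sum_le_sum fun k _ => ?_)
  refine Real.rpow_le_rpow (norm_nonneg _) ?_ hp0.le
  rw [norm_smul, Real.norm_eq_abs]
  exact mul_le_of_le_one_right (abs_nonneg _) (hf k)

theorem le_norm_sum_smul_of_unconditional {Ω : Type*} [MeasurableSpace Ω] {μ : Measure Ω}
    {u δ p : ℝ} (hu : 0 ≤ u) (hδ : 0 ≤ δ) (hp1 : 1 ≤ p) [Fact (1 ≤ ENNReal.ofReal p)]
    {n : ℕ} {f : Fin n → Lp ℝ (ENNReal.ofReal p) μ}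
    (huncond : IsUnconditionalWithFin u f)
    {A : Fin n → Set Ω} (hmeas : ∀ i, MeasurableSet (A i))
    (hdisj : Pairwise (Function.onFun Disjoint A))
    (hmass : ∀ j, δ ^ p ≤ ∫ x in A j, |(f j : Ω → ℝ) x| ^ p ∂μ) (a : Fin n → ℝ) :
    δ * (∑ k, |a k| ^ p) ^ (1 / p) ≤ u * ‖∑ k, a k • f k‖ := by
  have hp0 : 0 < p := by linarith
  have hS : 0 ≤ ∑ k, |a k| ^ p := Finset.sum_nonneg fun k _ => by positivity
  let φ (j : Fin n) (g : Lp ℝ (ENNReal.ofReal p) μ) : ℝ := ∫ x in A j, |(g : Ω → ℝ) x| ^ p ∂μ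
  let G (σ : Fin n → ℤˣ) : Lp ℝ (ENNReal.ofReal p) μ := ∑ k, ((σ k : ℤ) : ℝ) • a k • f k
  have hG (σ : Fin n → ℤˣ) : ∑ j, φ j (G σ) ≤ (u * ‖∑ k, a k • f k‖) ^ p := by
    refine (sum_setIntegral_abs_rpow_le hp1 hmeas hdisj (G σ)).trans
      (Real.rpow_le_rpow (norm_nonneg _) ?_ hp0.le)
    simp only [G, smul_smul]
    refine huncond a (fun k => ((σ k : ℤ) : ℝ)) fun k => ?_
    rcases Int.units_eq_one_or (σ k) with h | h <;> simp [h]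
  have hterm (j : Fin n) : (Fintype.card (Fin n → ℤˣ) : ℝ) * (δ ^ p * |a j| ^ p) ≤
      ∑ σ, φ j (G σ) := by
    refine le_trans ?_ (card_mul_le_sum_signs (φ j) (setIntegral_abs_sub_rpow_le hp1 (A j))
      (setIntegral_abs_smul_rpow (A j)) (fun k => a k • f k) j)
    refine mul_le_mul_of_nonneg_left ?_ (Nat.cast_nonneg _)
    simp only [φ]
    rw [setIntegral_abs_smul_rpow, mul_comm]
    exact mul_le_mul_of_nonneg_left (hmass j) (by positivity)
  have hpow : δ ^ p * ∑ k, |a k| ^ p ≤ (u * ‖∑ k, a k • f k‖) ^ p := by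
    have hcard : (0 : ℝ) < Fintype.card (Fin n → ℤˣ) := by exact_mod_cast Fintype.card_pos
    refine le_of_mul_le_mul_left ?_ hcard
    calc (Fintype.card (Fin n → ℤˣ) : ℝ) * (δ ^ p * ∑ k, |a k| ^ p)
        = ∑ j, (Fintype.card (Fin n → ℤˣ) : ℝ) * (δ ^ p * |a j| ^ p) := by
          rw [Finset.mul_sum, Finset.mul_sum]
      _ ≤ ∑ j, ∑ σ, φ j (G σ) := Finset.sum_le_sum fun j _ => hterm j
      _ = ∑ σ, ∑ j, φ j (G σ) := Finset.sum_comm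
      _ ≤ ∑ _σ : Fin n → ℤˣ, (u * ‖∑ k, a k • f k‖) ^ p := Finset.sum_le_sum fun σ _ => hG σ
      _ = _ := by rw [Finset.sum_const, Finset.card_univ, nsmul_eq_mul]
  rw [← Real.rpow_le_rpow_iff (by positivity) (by positivity) hp0,
    Real.mul_rpow hδ (by positivity), one_div, Real.rpow_inv_rpow hS hp0.ne']
  exact hpow

/-- (Commutative case of Lemma 3.2.) -/
theorem statement4
    {Ω : Type*} [MeasurableSpace Ω] (μ : Measure Ω) [IsProbabilityMeasure μ]
    (u δ p : ℝ) (hu : 1 ≤ u) (hδ : 0 < δ) (hp1 : 1 ≤ p) (hp2 : p < 2)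
    [Fact (1 ≤ ENNReal.ofReal p)]
    (n : ℕ) (f : Fin n → Lp ℝ (ENNReal.ofReal p) μ)
    (hf : ∀ i, ‖f i‖ ≤ 1)
    (huncond : IsUnconditionalWithFin u f)
    (A : Fin n → Set Ω) (hmeas : ∀ i, MeasurableSet (A i))
    (hdisj : Pairwise (Function.onFun Disjoint A))
    (hmass : ∀ j, δ ^ p ≤ ∫ x in A j, |(f j : Ω → ℝ) x| ^ p ∂μ) :
    IsLqBasisEquivFin p (u * Real.sqrt 3 / δ) f := by
  have hsqrt : 1 ≤ Real.sqrt 3 := Real.one_le_sqrt.2 (by norm_num)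
  intro a
  have hlower := le_norm_sum_smul_of_unconditional (by linarith) hδ.le hp1 huncond hmeas hdisj
    hmass a
  have hupper := norm_sum_smul_le_of_unconditional (by linarith) hp1 hp2.le hf huncond a
  have hS : 0 ≤ (∑ k, |a k| ^ p) ^ (1 / p) :=
    Real.rpow_nonneg (Finset.sum_nonneg fun k _ => by positivity) _
  constructor
  · rw [one_div_div, div_mul_eq_mul_div, div_le_iff₀ (by positivity)]
    refine hlower.trans ?_
    rw [mul_comm]
    exact mul_le_mul_of_nonneg_left (le_mul_of_one_le_right (by linarith) hsqrt) (norm_nonneg _)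
  · rcases isEmpty_or_nonempty (Fin n) with hn | ⟨⟨j⟩⟩
    · simp only [Finset.univ_eq_empty, Finset.sum_empty, norm_zero]
      positivity
    · have hδ1 : δ ≤ 1 := by
        rw [← Real.rpow_le_rpow_iff hδ.le zero_le_one (by linarith : 0 < p)]
        calc δ ^ p ≤ ∫ x in A j, |(f j : Ω → ℝ) x| ^ p ∂μ := hmass j
          _ ≤ ∫ x, |(f j : Ω → ℝ) x| ^ p ∂μ :=
            setIntegral_le_integral (integrable_abs_rpow_Lp hp1 _)
              (ae_of_all _ fun x => by positivity)
          _ = ‖f j‖ ^ p := (Lp_norm_rpow_eq_integral hp1 _).symm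
          _ ≤ 1 ^ p := Real.rpow_le_rpow (norm_nonneg _) (hf j) (by linarith)
      refine hupper.trans (mul_le_mul_of_nonneg_right ?_ hS)
      rw [le_div_iff₀ hδ]
      exact mul_le_mul_of_nonneg_left (hδ1.trans hsqrt) (by linarith)

end
end
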